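/- For every ε > 0 there exists n₀ such that the following holds: if G is a finite abelian group of order n ≥ n₀ such that 9 divides n and no prime p with p ≡ 2 (mod 3) divides n, then 3^{(1/3 − ε)·μ(G)} ≤ f_max(G) ≤ 3^{(1/3 + ε)·μ(G)}. -/

import Mathlib

/-- A subset `A` of an additive group is *sum-free* if there are no
`x, y, z ∈ A` (not necessarily distinct) with `x + y = z`. -/
def IsSumFree {G : Type*} [AddCommGroup G] (A : Set G) : Prop :=
  ∀ x ∈ A, ∀ y ∈ A, x + y ∉ A

/-- `A` is a maximal sum-free subset of `G`. -/
def IsMaximalSumFree {G : Type*} [AddCommGroup G] (A : Set G) : Prop :=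
  IsSumFree A ∧ ∀ B : Set G, IsSumFree B → A ⊆ B → A = B

/-- `μ(G)`: the maximum size of a sum-free subset of `G`. -/
noncomputable def sumFreeMu (G : Type*) [AddCommGroup G] [Fintype G] : ℕ :=
  sSup {k : ℕ | ∃ A : Set G, IsSumFree A ∧ A.ncard = k}

/-- `f_max(G)`: the number of maximal sum-free subsets of `G`. -/
noncomputable def fMaxSF (G : Type*) [AddCommGroup G] [Fintype G] : ℕ :=
  Nat.card {A : Set G // IsMaximalSumFree A}


open Finset

/-- `M` is a maximal independent subset of `s` with respect to the graph `Γ`. -/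
def IsMaximalIndepIn {V : Type*} (Γ : SimpleGraph V) (s M : Finset V) : Prop :=
  M ⊆ s ∧ Γ.IsIndepSet (M : Set V) ∧ ∀ z ∈ s, z ∉ M → ∃ x ∈ M, Γ.Adj z x

lemma cube_le_three_pow (k : ℕ) : k ^ 3 ≤ 3 ^ k := by
  rcases lt_or_ge k 3 with h | h
  · interval_cases k <;> norm_num
  induction k, h using Nat.le_induction with
  | base => norm_num
  | succ k hk ih =>
    calc (k + 1) ^ 3 ≤ 3 * k ^ 3 := by nlinarith [Nat.mul_le_mul hk hk]
      _ ≤ 3 ^ (k + 1) := by rw [pow_succ 3 k]; omega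

open Classical in
/-- **Moon–Moser theorem**: a graph on `m` vertices has at most `3 ^ (m / 3)` maximal independent
sets. -/
theorem card_isMaximalIndepIn_pow_three_le {V : Type*} (Γ : SimpleGraph V) (s : Finset V) :
    #{M ∈ s.powerset | IsMaximalIndepIn Γ s M} ^ 3 ≤ 3 ^ #s := by
  induction s using Finset.strongInduction with
  | H s ih =>
    rcases s.eq_empty_or_nonempty with rfl | hs
    · have : #{M ∈ (∅ : Finset V).powerset | IsMaximalIndepIn Γ ∅ M} ≤ 1 :=
        (card_filter_le _ _).trans (by simp)
      simpa using pow_le_pow_left₀ (Nat.zero_le _) this 3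
    set N : V → Finset V := fun u ↦ {w ∈ s | w = u ∨ Γ.Adj u w} with hN
    obtain ⟨v, hv, hmin⟩ := exists_min_image s (fun u ↦ #(N u)) hs
    set mis : Finset V → Finset (Finset V) :=
      fun t ↦ {M ∈ t.powerset | IsMaximalIndepIn Γ t M} with hmis
    have hself {u} (hu : u ∈ s) : u ∈ N u := by simp [hN, hu]
    have hsub (u) : N u ⊆ s := filter_subset _ _
    have hcover : mis s ⊆ (N v).biUnion fun u ↦ (mis (s \ N u)).image (insert u) := by
      intro M hM
      obtain ⟨-, hMs, hI, hmax⟩ := mem_filter.1 hM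
      obtain ⟨u, hu, huM⟩ : ∃ u ∈ N v, u ∈ M := by
        by_cases hvM : v ∈ M
        · exact ⟨v, hself hv, hvM⟩
        · obtain ⟨x, hx, hadj⟩ := hmax v hv hvM
          exact ⟨x, by simp [hN, hMs hx, hadj], hx⟩
      refine mem_biUnion.2 ⟨u, hu, mem_image.2 ⟨M.erase u, ?_, insert_erase huM⟩⟩
      have hsubset : M.erase u ⊆ s \ N u := by
        intro w hw
        obtain ⟨hwu, hwM⟩ := mem_erase.1 hw
        have : ¬ Γ.Adj u w := hI huM hwM (Ne.symm hwu)
        simp [hN, hMs hwM, hwu, this]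
      refine mem_filter.2 ⟨mem_powerset.2 hsubset, hsubset,
        hI.mono (by exact_mod_cast erase_subset _ _), fun z hz hzM ↦ ?_⟩
      simp only [hN, mem_sdiff, mem_filter, not_and, not_or] at hz
      obtain ⟨hzs, hz⟩ := hz
      obtain ⟨x, hx, hadj⟩ := hmax z hzs fun h ↦ hzM (mem_erase.2 ⟨(hz hzs).1, h⟩)
      refine ⟨x, mem_erase.2 ⟨?_, hx⟩, hadj⟩
      rintro rfl
      exact (hz hzs).2 hadj.symm
    obtain ⟨w, hw, hwmax⟩ := exists_max_image (N v) (fun u ↦ #(mis (s \ N u))) ⟨v, hself hv⟩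
    have hws : w ∈ s := hsub v hw
    have hbound : #(mis s) ≤ #(N v) * #(mis (s \ N w)) := by
      refine (card_le_card hcover).trans (card_biUnion_le_card_mul _ _ _ fun u hu ↦ ?_)
      exact card_image_le.trans (hwmax u hu)
    have hlt : s \ N w ⊂ s := sdiff_ssubset (hsub w) ⟨w, hself hws⟩
    calc #(mis s) ^ 3 ≤ (#(N v) * #(mis (s \ N w))) ^ 3 := by gcongr
      _ = #(N v) ^ 3 * #(mis (s \ N w)) ^ 3 := mul_pow _ _ _
      _ ≤ 3 ^ #(N v) * 3 ^ #(s \ N w) :=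
        Nat.mul_le_mul (cube_le_three_pow _) (ih _ hlt)
      _ ≤ 3 ^ #(N w) * 3 ^ #(s \ N w) := by
        exact Nat.mul_le_mul_right _ (Nat.pow_le_pow_right (by norm_num) (hmin w hws))
      _ = 3 ^ #s := by rw [← pow_add, add_comm, card_sdiff_add_card_eq_card (hsub w)]

open Classical in
/-- Graph container lemma: every independent subset of `C` lies in one of at most `β ^ #C` subsets
of `C`, each of which induces a graph of maximum degree at most `d`. -/
theorem exists_graph_containers {V : Type*} (Γ : SimpleGraph V) {β : ℝ} (hβ : 1 ≤ β) {d : ℕ}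
    (hd : β ^ d + 1 ≤ β ^ (d + 1)) (C : Finset V) :
    ∃ F : Finset (Finset V), (#F : ℝ) ≤ β ^ #C ∧
      (∀ I ⊆ C, Γ.IsIndepSet (I : Set V) → ∃ D ∈ F, I ⊆ D) ∧
      ∀ D ∈ F, D ⊆ C ∧ ∀ v ∈ D, #{w ∈ D | Γ.Adj v w} ≤ d := by
  induction C using Finset.strongInduction with
  | H C ih =>
    by_cases hC : ∀ v ∈ C, #{w ∈ C | Γ.Adj v w} ≤ d
    · refine ⟨{C}, by simpa using one_le_pow₀ hβ, fun I hI _ ↦ ⟨C, by simp, hI⟩, ?_⟩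
      simpa using hC
    push Not at hC
    obtain ⟨v, hv, hdeg⟩ := hC
    set N := {w ∈ C | Γ.Adj v w} with hN
    have hNsub : N ⊆ C.erase v := fun w hw ↦ by
      obtain ⟨hwC, hadj⟩ := mem_filter.1 hw
      exact mem_erase.2 ⟨hadj.ne', hwC⟩
    obtain ⟨F₁, hF₁, hcov₁, hdeg₁⟩ := ih _ (erase_ssubset hv)
    obtain ⟨F₂, hF₂, hcov₂, hdeg₂⟩ :=
      ih (C.erase v \ N) (sdiff_subset.trans_ssubset (erase_ssubset hv))
    have hcard₁ : #(C.erase v) + 1 = #C := card_erase_add_one hv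
    have hcard₂ : #(C.erase v \ N) + #N = #(C.erase v) := card_sdiff_add_card_eq_card hNsub
    refine ⟨F₁ ∪ F₂.image (insert v), ?_, fun I hI hind ↦ ?_, fun D hD ↦ ?_⟩
    · obtain ⟨k, hk⟩ : ∃ k, #C = k + (d + 1) := ⟨#C - (d + 1), by omega⟩
      have h₂ : β ^ #(C.erase v \ N) ≤ β ^ k := pow_le_pow_right₀ hβ (by omega)
      have h₁ : #(C.erase v) = k + d := by omega
      have hunion : (#(F₁ ∪ F₂.image (insert v)) : ℝ) ≤ #F₁ + #F₂ := by
        exact_mod_cast (card_union_le _ _).trans (Nat.add_le_add_left card_image_le _)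
      rw [h₁] at hF₁
      calc (#(F₁ ∪ F₂.image (insert v)) : ℝ) ≤ β ^ (k + d) + β ^ k := by linarith
        _ = β ^ k * (β ^ d + 1) := by ring
        _ ≤ β ^ k * β ^ (d + 1) := by gcongr
        _ = β ^ #C := by rw [hk, ← pow_add]
    · by_cases hvI : v ∈ I
      · obtain ⟨D, hD, hID⟩ := hcov₂ (I.erase v) (fun w hw ↦ by
          obtain ⟨hwv, hwI⟩ := mem_erase.1 hw
          have : ¬ Γ.Adj v w := hind hvI hwI (Ne.symm hwv)
          simp [hN, hwv, hI hwI, this]) (hind.mono (by exact_mod_cast erase_subset _ _))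
        refine ⟨insert v D, mem_union_right _ (mem_image_of_mem _ hD), ?_⟩
        rw [← insert_erase hvI]
        exact insert_subset_insert _ hID
      · obtain ⟨D, hD, hID⟩ := hcov₁ I (subset_erase.2 ⟨hI, hvI⟩) hind
        exact ⟨D, mem_union_left _ hD, hID⟩
    · rcases mem_union.1 hD with hD | hD
      · exact ⟨(hdeg₁ D hD).1.trans (erase_subset _ _), (hdeg₁ D hD).2⟩
      · obtain ⟨E, hE, rfl⟩ := mem_image.1 hD
        obtain ⟨hEsub, hEdeg⟩ := hdeg₂ E hE
        have hnadj {w} (hw : w ∈ E) : ¬ Γ.Adj v w := fun h ↦ by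
          have := mem_sdiff.1 (hEsub hw)
          exact this.2 (mem_filter.2 ⟨mem_of_mem_erase this.1, h⟩)
        refine ⟨insert_subset hv ((hEsub.trans sdiff_subset).trans (erase_subset _ _)),
          fun u hu ↦ ?_⟩
        rcases mem_insert.1 hu with rfl | hu
        · rw [filter_eq_empty_iff.2]
          · simp
          · intro w hw
            rcases mem_insert.1 hw with rfl | hw
            · exact Γ.irrefl
            · exact hnadj hw
        · rw [filter_insert, if_neg fun h ↦ hnadj hu h.symm]
          exact hEdeg u hu

/-- The pairs `(x, y)` of elements of `C` with `x + y ∈ C`. -/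
def schurPairs {G : Type*} [AddCommGroup G] [DecidableEq G] (C : Finset G) : Finset (G × G) :=
  {p ∈ C ×ˢ C | p.1 + p.2 ∈ C}

lemma mem_schurPairs {G : Type*} [AddCommGroup G] [DecidableEq G] {C : Finset G} {p : G × G} :
    p ∈ schurPairs C ↔ p.1 ∈ C ∧ p.2 ∈ C ∧ p.1 + p.2 ∈ C := by
  simp [schurPairs, and_assoc]


open SimpleGraph.TripartiteFromTriangles in
/-- A family of `k` Schur triples in `C`, no two of which agree in a coordinate, forces `C` to
have many Schur triples. -/
lemma triangleRemovalBound_le_card_schurPairs {G : Type*} [AddCommGroup G] [Fintype G]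
    [DecidableEq G] {ε : ℝ} {C : Finset G} {P : Finset (G × G)} (hPC : P ⊆ schurPairs C)
    (hfst : ∀ p ∈ P, ∀ q ∈ P, p.1 = q.1 → p = q) (hsnd : ∀ p ∈ P, ∀ q ∈ P, p.2 = q.2 → p = q)
    (hadd : ∀ p ∈ P, ∀ q ∈ P, p.1 + p.2 = q.1 + q.2 → p = q)
    (hP : 9 * ε * Fintype.card G ≤ #P) :
    27 * SimpleGraph.triangleRemovalBound ε * (Fintype.card G : ℝ) ^ 2 ≤ #(schurPairs C) := by
  set t : Finset (G × G × G) :=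
    {x | (x.2.1 - x.1, x.2.2 - x.2.1) ∈ P} with ht
  have htmem {a b c : G} : (a, b, c) ∈ t ↔ (b - a, c - b) ∈ P := by simp [ht]
  have hcard : #t = Fintype.card G * #P := by
    rw [← card_univ, ← card_product]
    refine (card_bij' (fun x _ ↦ (x.1, x.1 + x.2.1, x.1 + x.2.1 + x.2.2))
      (fun x _ ↦ (x.1, x.2.1 - x.1, x.2.2 - x.2.1)) ?_ ?_ ?_ ?_).symm
    · rintro ⟨x, a, b⟩ h
      simpa [htmem] using h
    · rintro ⟨x, a, b⟩ h
      simpa [htmem] using h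
    · rintro ⟨x, a, b⟩ h
      simp
    · rintro ⟨x, a, b⟩ h
      simp
  have : ExplicitDisjoint t := by
    constructor
    · intro a b c a' h h'
      have := hsnd _ (htmem.1 h) _ (htmem.1 h') rfl
      simpa using this
    · intro a b c b' h h'
      have := hadd _ (htmem.1 h) _ (htmem.1 h') (by simp)
      simpa using this
    · intro a b c c' h h'
      have := hfst _ (htmem.1 h) _ (htmem.1 h') rfl
      simpa using this
  have hfar : (graph t).FarFromTriangleFree ε := by
    apply farFromTriangleFree
    rw [hcard]
    push_cast
    nlinarith [(Nat.cast_nonneg (Fintype.card G) : (0 : ℝ) ≤ _)]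
  have hmany := hfar.le_card_cliqueFinset
  have hfew : #((graph t).cliqueFinset 3) ≤ Fintype.card G * #(schurPairs C) := by
    rw [← card_univ, ← card_product]
    refine card_le_card_of_surjOn
      (fun x ↦ toTriangle (x.1, x.1 + x.2.1, x.1 + x.2.1 + x.2.2)) ?_
    intro s hs
    rw [mem_coe, SimpleGraph.mem_cliqueFinset_iff, SimpleGraph.is3Clique_iff] at hs
    obtain ⟨x, y, z, hxy, hxz, hyz, rfl⟩ := hs
    obtain ⟨a, b, c, habc, hab, hac, hbc⟩ := graph_triple hxy hxz hyz
    obtain ⟨c', hc⟩ := Graph.in₀₁_iff.1 hab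
    obtain ⟨b', hb⟩ := Graph.in₀₂_iff.1 hac
    obtain ⟨a', ha⟩ := Graph.in₁₂_iff.1 hbc
    have h₁ := mem_schurPairs.1 (hPC (htmem.1 hc))
    have h₂ := mem_schurPairs.1 (hPC (htmem.1 hb))
    have h₃ := mem_schurPairs.1 (hPC (htmem.1 ha))
    refine ⟨(a, b - a, c - b), ?_, ?_⟩
    · simp only [coe_product, Set.mem_prod, mem_coe, mem_univ, true_and, mem_schurPairs]
      exact ⟨h₁.1, h₃.2.1, by simpa using h₂.2.2⟩
    · rw [← habc]
      simp
  have hpos : (0 : ℝ) < Fintype.card G := by exact_mod_cast Fintype.card_pos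
  have hfew' : (#((graph t).cliqueFinset 3) : ℝ) ≤ Fintype.card G * #(schurPairs C) := by
    exact_mod_cast hfew
  refine le_of_mul_le_mul_left ?_ hpos
  refine le_trans (le_of_eq ?_) (hmany.trans hfew')
  simp only [Fintype.card_sum]
  push_cast
  ring

open Classical in
/-- **Removal lemma** for Schur triples: a set with few Schur triples can be made sum-free by
removing few elements. -/
theorem exists_sumFree_sdiff {ε : ℝ} (hε : 0 < ε) :
    ∃ δ > 0, ∀ (G : Type) [AddCommGroup G] [Fintype G] (C : Finset G),
      (#(schurPairs C) : ℝ) < δ * (Fintype.card G : ℝ) ^ 2 →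
      ∃ B ⊆ C, (#B : ℝ) ≤ ε * Fintype.card G ∧ IsSumFree ((C \ B : Finset G) : Set G) := by
  refine ⟨27 * SimpleGraph.triangleRemovalBound (ε / 27),
    mul_pos (by norm_num) (SimpleGraph.triangleRemovalBound_pos (by positivity)), ?_⟩
  intro G _ _ C hC
  set verts : Finset (G × G) → Finset G := fun P ↦ P.biUnion fun p ↦ {p.1, p.2, p.1 + p.2}
    with hverts
  set good : Finset (Finset (G × G)) := {P ∈ (schurPairs C).powerset |
    (∀ p ∈ P, ∀ q ∈ P, p.1 = q.1 → p = q) ∧ (∀ p ∈ P, ∀ q ∈ P, p.2 = q.2 → p = q) ∧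
    (∀ p ∈ P, ∀ q ∈ P, p.1 + p.2 = q.1 + q.2 → p = q)} with hgood
  have hne : good.Nonempty := ⟨∅, by simp [hgood]⟩
  obtain ⟨P, hP, hmax⟩ := exists_max_image good card hne
  obtain ⟨hPC, hfst, hsnd, hadd⟩ := mem_filter.1 hP
  rw [mem_powerset] at hPC
  refine ⟨verts P, ?_, ?_, ?_⟩
  · intro x hx
    obtain ⟨p, hp, hx⟩ := mem_biUnion.1 hx
    have := mem_schurPairs.1 (hPC hp)
    simp only [mem_insert, mem_singleton] at hx
    rcases hx with rfl | rfl | rfl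
    exacts [this.1, this.2.1, this.2.2]
  · by_contra! hlt
    have h3 : #(verts P) ≤ #P * 3 := card_biUnion_le_card_mul _ _ _ fun p _ ↦ card_le_three
    have h3' : (#(verts P) : ℝ) ≤ #P * 3 := by exact_mod_cast h3
    exact hC.not_ge (triangleRemovalBound_le_card_schurPairs hPC hfst hsnd hadd (by linarith))
  · intro x hx y hy hxy
    simp only [coe_sdiff, Set.mem_sdiff, mem_coe] at hx hy hxy
    have hx' : ∀ p ∈ P, x ≠ p.1 := fun p hp h ↦ hx.2 (mem_biUnion.2 ⟨p, hp, by simp [h]⟩)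
    have hy' : ∀ p ∈ P, y ≠ p.2 := fun p hp h ↦ hy.2 (mem_biUnion.2 ⟨p, hp, by simp [h]⟩)
    have hxy' : ∀ p ∈ P, x + y ≠ p.1 + p.2 :=
      fun p hp h ↦ hxy.2 (mem_biUnion.2 ⟨p, hp, by simp [h]⟩)
    have hnot : (x, y) ∉ P := fun h ↦ hx' _ h rfl
    have hmem : insert (x, y) P ∈ good := by
      refine mem_filter.2 ⟨mem_powerset.2 (insert_subset ?_ hPC), ?_, ?_, ?_⟩
      · exact mem_schurPairs.2 ⟨hx.1, hy.1, hxy.1⟩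
      all_goals
        intro p hp q hq h
        rcases mem_insert.1 hp with rfl | hp' <;> rcases mem_insert.1 hq with rfl | hq'
      · rfl
      · exact absurd h (hx' _ hq')
      · exact absurd h.symm (hx' _ hp')
      · exact hfst _ hp' _ hq' h
      · rfl
      · exact absurd h (hy' _ hq')
      · exact absurd h.symm (hy' _ hp')
      · exact hsnd _ hp' _ hq' h
      · rfl
      · exact absurd h (hxy' _ hq')
      · exact absurd h.symm (hxy' _ hp')
      · exact hadd _ hp' _ hq' h
    have := hmax _ hmem
    rw [card_insert_of_notMem hnot] at this
    omega

/-- The graph in which `x` and `y` are adjacent if they differ by an element of `T`. -/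
def translationGraph {G : Type*} [AddCommGroup G] (T : Finset G) : SimpleGraph G :=
  SimpleGraph.fromRel fun x y ↦ ∃ s ∈ T, s + x = y

lemma translationGraph_adj {G : Type*} [AddCommGroup G] {T : Finset G} (h0 : 0 ∉ T) {s x : G}
    (hs : s ∈ T) : (translationGraph T).Adj x (s + x) := by
  refine (SimpleGraph.fromRel_adj _ _ _).2 ⟨?_, Or.inl ⟨s, hs, rfl⟩⟩
  intro h
  rw [right_eq_add] at h
  exact h0 (h ▸ hs)

lemma IsSumFree.isIndepSet_translationGraph {G : Type*} [AddCommGroup G] {T : Finset G}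
    {I : Set G} (hI : IsSumFree I) (hT : (T : Set G) ⊆ I) :
    (translationGraph T).IsIndepSet I := by
  intro x hx y hy _ hadj
  obtain ⟨-, ⟨s, hs, rfl⟩ | ⟨s, hs, rfl⟩⟩ := (SimpleGraph.fromRel_adj _ _ _).1 hadj
  · exact hI s (hT hs) x hx hy
  · exact hI s (hT hs) y hy hx

lemma IsSumFree.zero_notMem {G : Type*} [AddCommGroup G] {A : Set G} (hA : IsSumFree A) :
    (0 : G) ∉ A := fun h ↦ hA 0 h 0 h (by simpa using h)

lemma IsSumFree.mono {G : Type*} [AddCommGroup G] {A B : Set G} (hB : IsSumFree B)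
    (h : A ⊆ B) : IsSumFree A := fun x hx y hy hxy ↦ hB x (h hx) y (h hy) (h hxy)

open Classical in
lemma card_mul_le_of_translationGraph_degree_le {G : Type*} [AddCommGroup G]
    {T C D : Finset G} (h0 : 0 ∉ T) {d m : ℕ}
    (hd : ∀ v ∈ D, #{w ∈ D | (translationGraph T).Adj v w} ≤ d)
    (hm : ∀ s ∈ T, m ≤ #{x ∈ C | s + x ∈ C}) :
    #T * m ≤ #D * d + 2 * (#T * #(C \ D)) := by
  set P : Finset (G × G) := {p ∈ T ×ˢ C | p.1 + p.2 ∈ C} with hP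
  have hlow : #T * m ≤ #P := by
    have : #P = ∑ s ∈ T, #{x ∈ C | s + x ∈ C} := by
      rw [hP, card_filter, sum_product]
      simp only [card_filter]
    rw [this, ← smul_eq_mul]
    exact card_nsmul_le_sum _ _ _ hm
  have hsplit : P ⊆ {p ∈ T ×ˢ D | p.1 + p.2 ∈ D} ∪
      (T ×ˢ (C \ D) ∪ (T ×ˢ (C \ D)).image fun p ↦ (p.1, p.2 - p.1)) := by
    rintro ⟨s, x⟩ h
    simp only [hP, mem_filter, mem_product] at h
    by_cases hx : x ∈ D
    · by_cases hsx : s + x ∈ D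
      · exact mem_union_left _ (by simp [h.1.1, hx, hsx])
      · refine mem_union_right _ (mem_union_right _ (mem_image.2 ⟨(s, s + x), ?_, by simp⟩))
        simp [h.1.1, h.2, hsx]
    · refine mem_union_right _ (mem_union_left _ ?_)
      simp [h.1.1, h.1.2, hx]
  have hdense : #{p ∈ T ×ˢ D | p.1 + p.2 ∈ D} ≤ #D * d := by
    rw [card_filter, sum_product_right, ← smul_eq_mul]
    refine sum_le_card_nsmul _ _ _ fun x hx ↦ ?_
    rw [← card_filter]
    refine le_trans ?_ (hd x hx)
    refine card_le_card_of_injOn (fun s ↦ s + x) ?_ ((add_left_injective x).injOn)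
    intro s hs
    obtain ⟨hs, hsx⟩ := mem_filter.1 hs
    exact mem_filter.2 ⟨hsx, translationGraph_adj h0 hs⟩
  have hcard : #(T ×ˢ (C \ D)) = #T * #(C \ D) := card_product _ _
  have himage : #((T ×ˢ (C \ D)).image fun p ↦ (p.1, p.2 - p.1)) ≤ #(T ×ˢ (C \ D)) :=
    card_image_le
  have h₁ := card_le_card hsplit
  have h₂ := card_union_le {p ∈ T ×ˢ D | p.1 + p.2 ∈ D}
    (T ×ˢ (C \ D) ∪ (T ×ˢ (C \ D)).image fun p ↦ (p.1, p.2 - p.1))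
  have h₃ := card_union_le (T ×ˢ (C \ D)) ((T ×ˢ (C \ D)).image fun p ↦ (p.1, p.2 - p.1))
  omega

lemma card_powerset_filter_card_le {α : Type*} [DecidableEq α] (s : Finset α) (t : ℕ)
    (hs : s.Nonempty) : #{T ∈ s.powerset | #T ≤ t} ≤ (t + 1) * #s ^ t := by
  have hsub : {T ∈ s.powerset | #T ≤ t} ⊆ (range (t + 1)).biUnion fun i ↦ s.powersetCard i := by
    intro T hT
    obtain ⟨hT, hc⟩ := mem_filter.1 hT
    exact mem_biUnion.2 ⟨#T, by simp; omega, mem_powersetCard.2 ⟨mem_powerset.1 hT, rfl⟩⟩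
  refine (card_le_card hsub).trans ?_
  have := card_biUnion_le_card_mul (range (t + 1)) (fun i ↦ s.powersetCard i) (#s ^ t)
    fun i hi ↦ ?_
  · simpa using this
  · rw [card_powersetCard]
    exact (Nat.choose_le_pow _ _).trans
      (Nat.pow_le_pow_right hs.card_pos (by simpa [Nat.lt_succ_iff] using hi))

lemma exists_pow_add_one_le_pow_succ {β : ℝ} (hβ : 1 < β) :
    ∃ d : ℕ, β ^ d + 1 ≤ β ^ (d + 1) := by
  obtain ⟨d, hd⟩ := pow_unbounded_of_one_lt (1 / (β - 1)) hβ
  refine ⟨d, ?_⟩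
  have : 1 < β ^ d * (β - 1) := by rwa [div_lt_iff₀ (by linarith)] at hd
  rw [pow_succ]
  linarith

lemma exists_mul_pow_le_pow {β : ℝ} (hβ : 1 < β) (a : ℝ) (t : ℕ) :
    ∃ n₀ : ℕ, ∀ n ≥ n₀, a * (n : ℝ) ^ t ≤ β ^ n := by
  have h := (tendsto_pow_const_div_const_pow_of_one_lt t hβ).const_mul a
  rw [mul_zero] at h
  obtain ⟨n₀, hn₀⟩ := Filter.eventually_atTop.1 (h.eventually (gt_mem_nhds one_pos))
  refine ⟨n₀, fun n hn ↦ ?_⟩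
  have := hn₀ n hn
  rw [← mul_div_assoc, div_lt_one (by positivity)] at this
  exact this.le

open Classical in
/-- A set with many Schur triples has a small family of noticeably smaller subsets covering all its
sum-free subsets. -/
theorem exists_smaller_containers {δ : ℝ} (hδ : 0 < δ) {β : ℝ} (hβ : 1 < β) :
    ∃ n₀ : ℕ, ∀ (G : Type) [AddCommGroup G] [Fintype G], Fintype.card G ≥ n₀ →
      ∀ C : Finset G, δ * (Fintype.card G : ℝ) ^ 2 ≤ #(schurPairs C) →
      ∃ F : Finset (Finset G), (#F : ℝ) ≤ β ^ Fintype.card G ∧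
        (∀ I ⊆ C, IsSumFree (I : Set G) → ∃ D ∈ F, I ⊆ D) ∧
        ∀ D ∈ F, (#D : ℝ) ≤ #C - δ / 8 * Fintype.card G := by
  obtain ⟨γ, hγ, rfl⟩ : ∃ γ : ℝ, 1 < γ ∧ γ ^ 2 = β :=
    ⟨√β, by rwa [Real.lt_sqrt zero_le_one, one_pow], Real.sq_sqrt (by linarith)⟩
  obtain ⟨d, hd⟩ := exists_pow_add_one_le_pow_succ hγ
  obtain ⟨t, ht⟩ := exists_nat_gt (4 * d / δ)
  have ht0 : (0 : ℝ) < t := lt_of_le_of_lt (by positivity) ht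
  rw [div_lt_iff₀ hδ] at ht
  obtain ⟨n₁, hn₁⟩ := exists_mul_pow_le_pow hγ (t + 1) t
  obtain ⟨n₂, hn₂⟩ := exists_nat_gt (t / (3 * δ / 8))
  rw [div_lt_iff₀ (by positivity)] at hn₂
  refine ⟨max n₁ n₂, fun G _ _ hn C hC ↦ ?_⟩
  set n := Fintype.card G with hn_def
  have hnt : (t : ℝ) ≤ n * (3 * δ / 8) := by
    refine hn₂.le.trans ?_
    gcongr
    exact le_of_max_le_right hn
  have hn0 : (0 : ℝ) < n := by
    by_contra! h
    nlinarith
  have hCn : (#C : ℝ) ≤ n := by exact_mod_cast card_le_univ C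
  set m := ⌈δ / 2 * n⌉₊ with hm
  have hmle : δ / 2 * n ≤ m := Nat.le_ceil _
  set H : Finset G := {s ∈ C | m ≤ #{x ∈ C | s + x ∈ C}} with hH
  have hHC : H ⊆ C := filter_subset _ _
  have hHcard : δ / 2 * n ≤ #H := by
    have hsum : #(schurPairs C) = ∑ s ∈ C, #{x ∈ C | s + x ∈ C} := by
      rw [schurPairs, card_filter, sum_product]
      simp only [card_filter]
    have hle : (#(schurPairs C) : ℝ) ≤ #H * n + n * (δ / 2 * n) := by
      rw [hsum, ← sum_filter_add_sum_filter_not C fun s ↦ m ≤ #{x ∈ C | s + x ∈ C}]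
      push_cast
      refine add_le_add ?_ ?_
      · rw [← nsmul_eq_mul]
        refine sum_le_card_nsmul _ _ _ fun s _ ↦ ?_
        exact_mod_cast card_le_univ _
      · refine (sum_le_card_nsmul _ _ (δ / 2 * n) fun s hs ↦ ?_).trans ?_
        · exact (Nat.lt_ceil.1 (not_le.1 (mem_filter.1 hs).2)).le
        · rw [nsmul_eq_mul]
          gcongr
          exact_mod_cast card_le_univ _
    nlinarith
  choose K hKcard hKcov hKdeg using
    fun T : Finset G ↦ exists_graph_containers (translationGraph T) hγ.le hd C
  set index : Finset (Finset G) := {T ∈ {T ∈ (univ : Finset G).powerset | #T ≤ t} | 0 ∉ T}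
    with hindex
  set fam : Finset G → Finset (Finset G) := fun T ↦ if #T = t then K T else {(C \ H) ∪ T} with hfam
  have hone : (1 : ℝ) ≤ γ ^ n := one_le_pow₀ hγ.le
  refine ⟨index.biUnion fun T ↦ {D ∈ fam T | (#D : ℝ) ≤ #C - δ / 8 * n}, ?_, ?_, ?_⟩
  · have hfamcard (T : Finset G) : (#(fam T) : ℝ) ≤ γ ^ n := by
      by_cases hT : #T = t
      · simp only [hfam, hT, if_true]
        exact (hKcard T).trans (pow_le_pow_right₀ hγ.le (card_le_univ C))
      · simpa [hfam, hT] using hone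
    have hindexcard : (#index : ℝ) ≤ γ ^ n := by
      refine le_trans ?_ (hn₁ n (le_of_max_le_left hn))
      have : Nonempty G := ⟨0⟩
      have := (card_filter_le {T ∈ (univ : Finset G).powerset | #T ≤ t} fun T ↦ 0 ∉ T).trans
        (card_powerset_filter_card_le (univ : Finset G) t univ_nonempty)
      rw [card_univ] at this
      exact_mod_cast this
    calc ((#(index.biUnion fun T ↦ {D ∈ fam T | (#D : ℝ) ≤ #C - δ / 8 * n}) : ℕ) : ℝ)
        ≤ ∑ T ∈ index, (#{D ∈ fam T | (#D : ℝ) ≤ #C - δ / 8 * n} : ℝ) := by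
          exact_mod_cast card_biUnion_le
      _ ≤ ∑ T ∈ index, γ ^ n := by
          refine sum_le_sum fun T _ ↦ le_trans ?_ (hfamcard T)
          exact_mod_cast card_filter_le _ _
      _ = #index * γ ^ n := by rw [sum_const, nsmul_eq_mul]
      _ ≤ γ ^ n * γ ^ n := by gcongr
      _ = (γ ^ 2) ^ n := by ring
  · intro I hIC hI
    by_cases hIH : t ≤ #(I ∩ H)
    · obtain ⟨T, hTI, hTt⟩ := exists_subset_card_eq hIH
      have h0 : 0 ∉ T := fun h ↦ hI.zero_notMem (by exact_mod_cast (mem_inter.1 (hTI h)).1)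
      obtain ⟨D, hD, hID⟩ := hKcov T I hIC (hI.isIndepSet_translationGraph
        (by exact_mod_cast hTI.trans inter_subset_left))
      refine ⟨D, mem_biUnion.2 ⟨T, by simp [hindex, hTt, h0], mem_filter.2
        ⟨by simpa [hfam, hTt] using hD, ?_⟩⟩, hID⟩
      obtain ⟨hDC, hDdeg⟩ := hKdeg T D hD
      have hcount := card_mul_le_of_translationGraph_degree_le (C := C) (m := m) h0 hDdeg
        fun s hs ↦ (mem_filter.1 (mem_inter.1 (hTI hs)).2).2
      have hDcard := card_sdiff_add_card_eq_card hDC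
      rw [hTt] at hcount
      have hcount' : (t * m : ℝ) ≤ #D * d + 2 * (t * #(C \ D)) := by exact_mod_cast hcount
      have hDcard' : (#(C \ D) + #D : ℝ) = #C := by exact_mod_cast hDcard
      have hDn : (#D * d : ℝ) ≤ n * d := by
        gcongr
        exact_mod_cast card_le_univ _
      have h₁ : t * (δ / 2 * n) ≤ (t * m : ℝ) := by gcongr
      have h₂ : (n * d : ℝ) ≤ n * (t * δ / 4) := by
        gcongr
        linarith
      have h₃ : t * (δ / 8 * n) ≤ (t * #(C \ D) : ℝ) := by linarith
      have := le_of_mul_le_mul_left h₃ ht0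
      linarith
    · push Not at hIH
      refine ⟨(C \ H) ∪ (I ∩ H), mem_biUnion.2 ⟨I ∩ H, ?_, mem_filter.2 ⟨?_, ?_⟩⟩, ?_⟩
      · have : (0 : G) ∉ I := fun h ↦ hI.zero_notMem (by exact_mod_cast h)
        simp [hindex, hIH.le, this]
      · simp [hfam, hIH.ne]
      · have h₁ : (#((C \ H) ∪ (I ∩ H)) : ℝ) ≤ #(C \ H) + #(I ∩ H) := by
          exact_mod_cast card_union_le _ _
        have h₂ : (#(C \ H) + #H : ℝ) = #C := by
          exact_mod_cast card_sdiff_add_card_eq_card hHC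
        have h₃ : (#(I ∩ H) : ℝ) ≤ t := by exact_mod_cast hIH.le
        linarith
      · intro x hx
        by_cases hxH : x ∈ H
        · simp [hx, hxH]
        · simp [hIC hx, hxH]
  · intro D hD
    obtain ⟨T, -, hD⟩ := mem_biUnion.1 hD
    exact (mem_filter.1 hD).2

open Classical in
/-- **Container theorem** for sum-free sets: all sum-free sets are covered by subexponentially many
sets with few Schur triples. -/
theorem exists_sumFree_containers {δ : ℝ} (hδ : 0 < δ) {β : ℝ} (hβ : 1 < β) :
    ∃ n₀ : ℕ, ∀ (G : Type) [AddCommGroup G] [Fintype G], Fintype.card G ≥ n₀ →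
      ∃ F : Finset (Finset G), (#F : ℝ) ≤ β ^ Fintype.card G ∧
        (∀ I : Finset G, IsSumFree (I : Set G) → ∃ D ∈ F, I ⊆ D) ∧
        ∀ D ∈ F, (#(schurPairs D) : ℝ) < δ * (Fintype.card G : ℝ) ^ 2 := by
  obtain ⟨k, hk⟩ := exists_nat_gt (8 / δ)
  have hk0 : k ≠ 0 := by
    rintro rfl
    rw [Nat.cast_zero] at hk
    exact hk.not_ge (div_nonneg (by norm_num) hδ.le)
  obtain ⟨γ, hγ, rfl⟩ : ∃ γ : ℝ, 1 < γ ∧ γ ^ k = β :=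
    ⟨β ^ (1 / k : ℝ), Real.one_lt_rpow hβ (by positivity), by
      rw [one_div, Real.rpow_inv_natCast_pow (by linarith) hk0]⟩
  obtain ⟨n₀, hn₀⟩ := exists_smaller_containers hδ hγ
  refine ⟨max n₀ 1, fun G _ _ hn ↦ ?_⟩
  have hstep := hn₀ G (le_of_max_le_left hn)
  have hn0 : (0 : ℝ) < Fintype.card G := by exact_mod_cast le_of_max_le_right hn
  set n := Fintype.card G with hn_def
  have hiter : ∀ (j : ℕ) (C : Finset G), (#C : ℝ) ≤ j * (δ / 8 * n) →
      ∃ F : Finset (Finset G), (#F : ℝ) ≤ (γ ^ j) ^ n ∧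
        (∀ I ⊆ C, IsSumFree (I : Set G) → ∃ D ∈ F, I ⊆ D) ∧
        ∀ D ∈ F, (#(schurPairs D) : ℝ) < δ * (n : ℝ) ^ 2 := by
    intro j
    induction j with
    | zero =>
      intro C hC
      obtain rfl : C = ∅ := by
        rw [← card_eq_zero]
        exact_mod_cast le_antisymm (hC.trans (by simp)) (Nat.cast_nonneg _)
      refine ⟨{∅}, by simp, fun I hI _ ↦ ⟨∅, by simp, hI⟩, ?_⟩
      have : 0 < δ * (n : ℝ) ^ 2 := mul_pos hδ (pow_pos hn0 2)
      simpa [schurPairs] using this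
    | succ j ih =>
      intro C hC
      by_cases hfew : (#(schurPairs C) : ℝ) < δ * (n : ℝ) ^ 2
      · refine ⟨{C}, ?_, fun I hI _ ↦ ⟨C, by simp, hI⟩, by simpa using hfew⟩
        simpa using one_le_pow₀ (one_le_pow₀ hγ.le)
      obtain ⟨F, hF, hcov, hsmall⟩ := hstep C (not_lt.1 hfew)
      have hF' : ∀ D ∈ F, ∃ E : Finset (Finset G), (#E : ℝ) ≤ (γ ^ j) ^ n ∧
          (∀ I ⊆ D, IsSumFree (I : Set G) → ∃ D ∈ E, I ⊆ D) ∧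
          ∀ D ∈ E, (#(schurPairs D) : ℝ) < δ * (n : ℝ) ^ 2 := by
        intro D hD
        refine ih D ((hsmall D hD).trans ?_)
        push_cast at hC
        linarith
      choose! E hE hEcov hEfew using hF'
      refine ⟨F.biUnion E, ?_, ?_, ?_⟩
      · calc (#(F.biUnion E) : ℝ) ≤ ∑ D ∈ F, (#(E D) : ℝ) := by exact_mod_cast card_biUnion_le
          _ ≤ ∑ D ∈ F, (γ ^ j) ^ n := sum_le_sum hE
          _ = #F * (γ ^ j) ^ n := by rw [sum_const, nsmul_eq_mul]
          _ ≤ γ ^ n * (γ ^ j) ^ n := by gcongr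
          _ = (γ ^ (j + 1)) ^ n := by ring
      · intro I hI hIfree
        obtain ⟨D, hD, hID⟩ := hcov I hI hIfree
        obtain ⟨D', hD', hID'⟩ := hEcov D hD I hID hIfree
        exact ⟨D', mem_biUnion.2 ⟨D, hD, hD'⟩, hID'⟩
      · intro D hD
        obtain ⟨D', hD', hD⟩ := mem_biUnion.1 hD
        exact hEfew D' hD' D hD
  obtain ⟨F, hF, hcov, hfew⟩ := hiter k univ (by
    rw [card_univ, ← mul_assoc]
    refine le_mul_of_one_le_left hn0.le ?_
    rw [div_lt_iff₀ hδ] at hk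
    linarith)
  exact ⟨F, hF, fun I ↦ hcov I (subset_univ I), hfew⟩

lemma ncard_le_sumFreeMu {G : Type*} [AddCommGroup G] [Fintype G] {A : Set G} (hA : IsSumFree A) :
    A.ncard ≤ sumFreeMu G := by
  refine le_csSup ⟨Nat.card G, ?_⟩ ⟨A, hA, rfl⟩
  rintro _ ⟨B, -, rfl⟩
  exact Set.ncard_le_card B

lemma exists_ncard_eq_sumFreeMu (G : Type*) [AddCommGroup G] [Fintype G] :
    ∃ A : Set G, IsSumFree A ∧ A.ncard = sumFreeMu G := by
  refine Nat.sSup_mem (s := {k : ℕ | ∃ A : Set G, IsSumFree A ∧ A.ncard = k}) ?_ ⟨Nat.card G, ?_⟩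
  · exact ⟨0, ∅, fun x hx ↦ hx.elim, Set.ncard_empty G⟩
  · rintro _ ⟨B, -, rfl⟩
    exact Set.ncard_le_card B

open Classical in
lemma fMaxSF_eq_card (G : Type*) [AddCommGroup G] [Fintype G] :
    fMaxSF G = #{I : Finset G | IsMaximalSumFree (I : Set G)} := by
  rw [fMaxSF, ← Nat.card_eq_finsetCard]
  refine Nat.card_congr ((Fintype.finsetEquivSet.subtypeEquiv fun I ↦ ?_).symm)
  simp

/-- The link graph of `S`: distinct `x` and `y` are adjacent if `S ∪ {x, y}` is not sum-free. -/
def linkGraph {G : Type*} [AddCommGroup G] (S : Set G) : SimpleGraph G :=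
  SimpleGraph.fromRel fun x y ↦ ¬ IsSumFree (S ∪ {x, y})

lemma linkGraph_adj {G : Type*} [AddCommGroup G] {S : Set G} {x y : G} :
    (linkGraph S).Adj x y ↔ x ≠ y ∧ ¬ IsSumFree (S ∪ {x, y}) := by
  rw [linkGraph, SimpleGraph.fromRel_adj, Set.pair_comm y x, or_self]

open Classical in
/-- A maximal sum-free set inside `A ∪ B` with `A` sum-free meets `A` in a maximal independent set
of the link graph of its trace on `B`. -/
lemma IsMaximalSumFree.isMaximalIndepIn_linkGraph {G : Type*} [AddCommGroup G]
    {A B I : Finset G} (hA : IsSumFree (A : Set G)) (hI : IsMaximalSumFree (I : Set G))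
    (hIAB : I ⊆ A ∪ B) :
    IsMaximalIndepIn (linkGraph ((I ∩ B : Finset G) : Set G))
      {x ∈ A | IsSumFree (((I ∩ B : Finset G) : Set G) ∪ {x})} (I ∩ A) := by
  refine ⟨fun x hx ↦ ?_, fun x hx y hy _ hadj ↦ ?_, fun z hz hzI ↦ ?_⟩
  · obtain ⟨hxI, hxA⟩ := mem_inter.1 hx
    refine mem_filter.2 ⟨hxA, hI.1.mono ?_⟩
    intro w hw
    simp only [coe_inter, Set.union_singleton, Set.mem_insert_iff, Set.mem_inter_iff, mem_coe] at hw
    rcases hw with rfl | hw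
    exacts [hxI, hw.1]
  · refine (linkGraph_adj.1 hadj).2 (hI.1.mono ?_)
    simp only [coe_inter, Set.mem_inter_iff, mem_coe] at hx hy
    intro w hw
    simp only [coe_inter, Set.mem_union, Set.mem_insert_iff, Set.mem_singleton_iff,
      Set.mem_inter_iff, mem_coe] at hw
    rcases hw with hw | rfl | rfl
    exacts [hw.1, hx.1, hy.1]
  · obtain ⟨hzA, hz⟩ := mem_filter.1 hz
    have hzI' : z ∉ I := fun h ↦ hzI (mem_inter.2 ⟨h, hzA⟩)
    by_contra! hcon
    have hpair : ∀ x ∈ I ∩ A, IsSumFree (((I ∩ B : Finset G) : Set G) ∪ {z, x}) := by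
      intro x hx
      by_contra h
      refine hcon x hx (linkGraph_adj.2 ⟨?_, h⟩)
      rintro rfl
      exact hzI hx
    have hins : IsSumFree (insert z (I : Set G)) := by
      set S : Set G := ((I ∩ B : Finset G) : Set G) with hS
      have hfree : ∀ m, m = z ∨ m ∈ I ∩ A → IsSumFree (S ∪ {z, m}) := by
        rintro m (rfl | hm)
        · rwa [Set.pair_eq_singleton]
        · exact hpair m hm
      have hmem {w : G} (hw : w ∈ insert z (I : Set G)) (hwS : ¬ (w = z ∨ w ∈ S)) :
          w ∈ I ∩ A := by
        rcases hw with rfl | hw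
        · exact absurd (Or.inl rfl) hwS
        · rcases mem_union.1 (hIAB hw) with h | h
          · exact mem_inter.2 ⟨hw, h⟩
          · exact absurd (Or.inr (by simpa [hS] using ⟨hw, h⟩)) hwS
      have hcommon {w m : G} (hw : w = z ∨ w ∈ S) : w ∈ S ∪ {z, m} := by
        rcases hw with rfl | hw
        · simp
        · exact Or.inl hw
      have hbad {x y w : G} (hx : x ∈ I ∩ A) (hy : y ∈ I ∩ A) (hw : w ∈ insert z (I : Set G)) :
          (x ∈ I ∧ y ∈ I ∧ w ∈ I) ∨ (x ∈ A ∧ y ∈ A ∧ w ∈ A) := by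
        rw [mem_inter] at hx hy
        rcases hw with rfl | hw
        · exact Or.inr ⟨hx.2, hy.2, hzA⟩
        · exact Or.inl ⟨hx.1, hy.1, hw⟩
      intro a ha b hb hab
      by_cases h₁ : a = z ∨ a ∈ S <;> by_cases h₂ : b = z ∨ b ∈ S <;>
        by_cases h₃ : a + b = z ∨ a + b ∈ S
      · exact hfree z (Or.inl rfl) a (hcommon h₁) b (hcommon h₂) (hcommon h₃)
      · exact hfree _ (Or.inr (hmem hab h₃)) a (hcommon h₁) b (hcommon h₂) (by simp)
      · exact hfree _ (Or.inr (hmem hb h₂)) a (hcommon h₁) b (by simp) (hcommon h₃)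
      · rcases hbad (hmem hb h₂) (hmem hab h₃) ha with h | h
        · exact hI.1 a h.2.2 b h.1 h.2.1
        · exact hA a h.2.2 b h.1 h.2.1
      · exact hfree _ (Or.inr (hmem ha h₁)) a (by simp) b (hcommon h₂) (hcommon h₃)
      · rcases hbad (hmem ha h₁) (hmem hab h₃) hb with h | h
        · exact hI.1 a h.1 b h.2.2 h.2.1
        · exact hA a h.1 b h.2.2 h.2.1
      all_goals
        rcases hbad (hmem ha h₁) (hmem hb h₂) hab with h | h
        · exact hI.1 a h.1 b h.2.1 h.2.2
        · exact hA a h.1 b h.2.1 h.2.2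
    have := hI.2 _ hins (Set.subset_insert _ _)
    exact hzI' (mem_coe.1 (this.symm ▸ Set.mem_insert z (I : Set G)))

open Classical in
/-- A set that is sum-free up to `B` contains few maximal sum-free sets. -/
lemma card_isMaximalSumFree_subset_pow_three_le {G : Type*} [AddCommGroup G] [Fintype G]
    {A B : Finset G} (hA : IsSumFree (A : Set G)) :
    #{I : Finset G | IsMaximalSumFree (I : Set G) ∧ I ⊆ A ∪ B} ^ 3 ≤ 2 ^ (3 * #B) * 3 ^ #A := by
  set L : Finset G → Finset (Finset G) := fun S ↦
    {M ∈ ({x ∈ A | IsSumFree ((S : Set G) ∪ {x})} : Finset G).powerset |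
      IsMaximalIndepIn (linkGraph (S : Set G)) {x ∈ A | IsSumFree ((S : Set G) ∪ {x})} M} with hL
  have hLcard (S : Finset G) : #(L S) ^ 3 ≤ 3 ^ #A :=
    (card_isMaximalIndepIn_pow_three_le _ _).trans
      (Nat.pow_le_pow_right (by norm_num) (card_filter_le _ _))
  have hne : B.powerset.Nonempty := ⟨∅, empty_mem_powerset B⟩
  obtain ⟨S₀, -, hS₀⟩ := exists_max_image B.powerset (fun S ↦ #(L S)) hne
  have hle : #{I : Finset G | IsMaximalSumFree (I : Set G) ∧ I ⊆ A ∪ B} ≤ 2 ^ #B * #(L S₀) := by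
    have hcover : ({I : Finset G | IsMaximalSumFree (I : Set G) ∧ I ⊆ A ∪ B} : Finset _) ⊆
        B.powerset.biUnion fun S ↦ (L S).image fun M ↦ S ∪ M := by
      intro I hI
      obtain ⟨hI, hIAB⟩ := (mem_filter.1 hI).2
      refine mem_biUnion.2 ⟨I ∩ B, mem_powerset.2 inter_subset_right, mem_image.2 ⟨I ∩ A, ?_, ?_⟩⟩
      · have := hI.isMaximalIndepIn_linkGraph hA hIAB
        exact mem_filter.2 ⟨mem_powerset.2 this.1, this⟩
      · rw [← inter_union_distrib_left, union_comm B, inter_eq_left.2 hIAB]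
    refine (card_le_card hcover).trans ?_
    rw [← card_powerset]
    exact card_biUnion_le_card_mul _ _ _ fun S hS ↦ card_image_le.trans (hS₀ S hS)
  calc _ ≤ (2 ^ #B * #(L S₀)) ^ 3 := Nat.pow_le_pow_left hle 3
    _ = 2 ^ (3 * #B) * #(L S₀) ^ 3 := by ring
    _ ≤ 2 ^ (3 * #B) * 3 ^ #A := Nat.mul_le_mul_left _ (hLcard S₀)

/-- The stabilizer of a set under translation. -/
def translationStabilizer {G : Type*} [AddCommGroup G] (C : Set G) : AddSubgroup G where
  carrier := {g | ∀ x, x + g ∈ C ↔ x ∈ C}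
  zero_mem' := by simp
  add_mem' {a b} ha hb x := by rw [← add_assoc, hb, ha]
  neg_mem' {a} ha x := by rw [← ha, neg_add_cancel_right]

lemma mem_translationStabilizer {G : Type*} [AddCommGroup G] {C : Set G} {g : G} :
    g ∈ translationStabilizer C ↔ ∀ x, x + g ∈ C ↔ x ∈ C := Iff.rfl

lemma card_le_ncard_of_add_mem {G : Type*} [AddCommGroup G] [Finite G] {K : AddSubgroup G}
    {P : Set G} (hP : P.Nonempty) (hK : ∀ x ∈ P, ∀ k ∈ K, x + k ∈ P) : Nat.card K ≤ P.ncard := by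
  obtain ⟨x, hx⟩ := hP
  rw [← SetLike.coe_sort_coe, Nat.card_coe_set_eq,
    ← Set.ncard_image_of_injective (K : Set G) (add_right_injective x)]
  refine Set.ncard_le_ncard ?_ (Set.toFinite _)
  rintro _ ⟨k, hk, rfl⟩
  exact hK x hx k hk

/-- Sums of elements of two subgroups are repeated at most `|H₁ ∩ H₂|` times. -/
lemma ncard_mul_ncard_le {G : Type*} [AddCommGroup G] [Finite G] {H₁ H₂ : AddSubgroup G}
    {V W : Set G} (hV : V ⊆ H₁) (hW : W ⊆ H₂) {E : Set G} (c : G)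
    (hE : ∀ x ∈ V, ∀ y ∈ W, c + x + y ∈ E) :
    V.ncard * W.ncard ≤ Nat.card (H₁ ⊓ H₂ : AddSubgroup G) * E.ncard := by
  classical
  have := Fintype.ofFinite G
  rw [← Set.ncard_prod, Set.ncard_eq_toFinset_card' (V ×ˢ W), Set.ncard_eq_toFinset_card' E]
  refine card_le_mul_card_image_of_maps_to (f := fun p : G × G ↦ c + p.1 + p.2) ?_ _ ?_
  · rintro ⟨x, y⟩ h
    rw [Set.mem_toFinset, Set.mem_prod] at h
    simpa using hE x h.1 y h.2
  · intro e he
    rcases ({p ∈ (V ×ˢ W).toFinset | c + p.1 + p.2 = e} : Finset (G × G)).eq_empty_or_nonempty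
      with h | ⟨⟨x₀, y₀⟩, h₀⟩
    · rw [h]; simp
    rw [← SetLike.coe_sort_coe, Nat.card_coe_set_eq, Set.ncard_eq_toFinset_card']
    simp only [Set.toFinset_prod, mem_filter, mem_product, Set.mem_toFinset] at h₀
    refine card_le_card_of_injOn (fun p ↦ p.1 - x₀) ?_ ?_
    · rintro ⟨x, y⟩ h
      simp only [Set.toFinset_prod, coe_filter, mem_product, Set.mem_toFinset,
        Set.mem_ofPred_eq] at h
      have hxy : x - x₀ = y₀ - y := by
        have := h.2.trans h₀.2.symm
        rw [add_assoc, add_assoc, add_right_inj] at this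
        rw [sub_eq_sub_iff_add_eq_add, this, add_comm]
      simp only [Set.coe_toFinset, SetLike.mem_coe, AddSubgroup.mem_inf]
      exact ⟨sub_mem (hV h.1.1) (hV h₀.1.1), hxy ▸ sub_mem (hW h₀.1.2) (hW h.1.2)⟩
    · rintro ⟨x, y⟩ h ⟨x', y'⟩ h' heq
      simp only [Set.toFinset_prod, coe_filter, mem_product, Set.mem_toFinset,
        Set.mem_ofPred_eq] at h h'
      obtain rfl : x = x' := by simpa using heq
      have := h.2.trans h'.2.symm
      simpa using this

/-- Arithmetic core of Kemperman's lemma. -/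
lemma add_le_add_of_mul_le_mul {k u p v q e f : ℕ} (hk : 0 < k) (hu : k ≤ u) (hp : k ≤ p)
    (hv : k ≤ v) (hq : k ≤ q) (he : v * p ≤ k * e) (hf : q * u ≤ k * f) :
    (u + p) + (v + q) ≤ (e + k) + (f + k) := by
  obtain ⟨u, rfl⟩ := Nat.exists_eq_add_of_le hu
  obtain ⟨p, rfl⟩ := Nat.exists_eq_add_of_le hp
  obtain ⟨v, rfl⟩ := Nat.exists_eq_add_of_le hv
  obtain ⟨q, rfl⟩ := Nat.exists_eq_add_of_le hq
  refine le_of_mul_le_mul_left ?_ hk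
  nlinarith [Nat.zero_le (v * p), Nat.zero_le (q * u)]

/-- Local structure of two sets around a point `c`: `u, p` count the elements of the stabilizer of
`C₂` that translate `c` into and out of `C₁`, and `v, q` vice versa. -/
lemma exists_local_counts {G : Type*} [AddCommGroup G] [Finite G] (C₁ C₂ : Set G) (c : G) {k : ℕ}
    (hk : k = Nat.card (translationStabilizer C₁ ⊓ translationStabilizer C₂ : AddSubgroup G)) :
    ∃ u p v q : ℕ, u + p = Nat.card (translationStabilizer C₂) ∧
      v + q = Nat.card (translationStabilizer C₁) ∧
      v * p ≤ k * (C₂ \ C₁).ncard ∧ q * u ≤ k * (C₁ \ C₂).ncard ∧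
      (u = 0 ∨ k ≤ u) ∧ (p = 0 ∨ k ≤ p) ∧ (v = 0 ∨ k ≤ v) ∧ (q = 0 ∨ k ≤ q) ∧
      (c ∈ C₁ → k ≤ u) ∧ (c ∉ C₁ → k ≤ p) ∧ (c ∈ C₂ → k ≤ v) ∧ (c ∉ C₂ → k ≤ q) := by
  set H₁ := translationStabilizer C₁ with hH₁
  set H₂ := translationStabilizer C₂ with hH₂
  have key (H : AddSubgroup G) (C : Set G) (hH : H₁ ⊓ H₂ ≤ H)
      (hC : H₁ ⊓ H₂ ≤ translationStabilizer C) :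
      ((H : Set G) ∩ {y | c + y ∈ C}).ncard = 0 ∨ k ≤ ((H : Set G) ∩ {y | c + y ∈ C}).ncard := by
    rcases ((H : Set G) ∩ {y | c + y ∈ C}).eq_empty_or_nonempty with h | h
    · exact Or.inl (by rw [h, Set.ncard_empty])
    · rw [hk]
      refine Or.inr (card_le_ncard_of_add_mem h fun x hx z hz ↦ ⟨add_mem hx.1 (hH hz), ?_⟩)
      change c + (x + z) ∈ C
      rw [← add_assoc, mem_translationStabilizer.1 (hC hz)]
      exact hx.2
  have hcompl (C : Set G) : translationStabilizer C ≤ translationStabilizer Cᶜ :=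
    fun g hg x ↦ not_congr (hg x)
  have pos {H : AddSubgroup G} {C : Set G} (hc : c ∈ C)
      (h : ((H : Set G) ∩ {y | c + y ∈ C}).ncard = 0 ∨
        k ≤ ((H : Set G) ∩ {y | c + y ∈ C}).ncard) :
      k ≤ ((H : Set G) ∩ {y | c + y ∈ C}).ncard := by
    refine h.resolve_left fun h0 ↦ ?_
    rw [Set.ncard_eq_zero] at h0
    have : (0 : G) ∈ (H : Set G) ∩ {y | c + y ∈ C} := ⟨zero_mem H, by simpa using hc⟩
    rw [h0] at this
    exact this
  have hsplit (H : AddSubgroup G) (C : Set G) :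
      ((H : Set G) ∩ {y | c + y ∈ C}).ncard + ((H : Set G) ∩ {y | c + y ∈ Cᶜ}).ncard =
        Nat.card H := by
    rw [← SetLike.coe_sort_coe, Nat.card_coe_set_eq]
    exact Set.ncard_inter_add_ncard_sdiff_eq_ncard _ _ (Set.toFinite _)
  have hu := key H₂ C₁ inf_le_right inf_le_left
  have hp := key H₂ C₁ᶜ inf_le_right (inf_le_left.trans (hcompl C₁))
  have hv := key H₁ C₂ inf_le_left inf_le_right
  have hq := key H₁ C₂ᶜ inf_le_left (inf_le_right.trans (hcompl C₂))
  refine ⟨_, _, _, _, hsplit H₂ C₁, hsplit H₁ C₂, ?_, ?_, hu, hp, hv, hq,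
    fun h ↦ pos h hu, fun h ↦ pos h hp, fun h ↦ pos h hv, fun h ↦ pos h hq⟩
  · rw [hk]
    refine ncard_mul_ncard_le Set.inter_subset_left Set.inter_subset_left c
      fun x hx y hy ↦ ⟨?_, ?_⟩
    · exact (mem_translationStabilizer.1 hy.1 _).2 hx.2
    · rw [add_right_comm, mem_translationStabilizer.1 hx.1]
      exact hy.2
  · rw [hk]
    refine ncard_mul_ncard_le Set.inter_subset_left Set.inter_subset_left c
      fun x hx y hy ↦ ⟨?_, ?_⟩
    · rw [add_right_comm, mem_translationStabilizer.1 hx.1]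
      exact hy.2
    · rw [mem_translationStabilizer.1 hy.1]
      exact hx.2

/-- **Kemperman's lemma** on unions. -/
lemma le_ncard_union_add_card_stabilizer {G : Type*} [AddCommGroup G] [Finite G] {C₁ C₂ : Set G}
    {N : ℕ} (h₁ : N ≤ C₁.ncard + Nat.card (translationStabilizer C₁))
    (h₂ : N ≤ C₂.ncard + Nat.card (translationStabilizer C₂)) :
    N ≤ (C₁ ∪ C₂).ncard + Nat.card (translationStabilizer (C₁ ∪ C₂)) := by
  rcases (C₂ \ C₁).eq_empty_or_nonempty with h | ⟨c, hc⟩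
  · rwa [Set.union_eq_left.2 (Set.sdiff_eq_empty.1 h)]
  rcases (C₁ \ C₂).eq_empty_or_nonempty with h | ⟨c', hc'⟩
  · rwa [Set.union_eq_right.2 (Set.sdiff_eq_empty.1 h)]
  obtain ⟨k, hk⟩ : ∃ k, k =
    Nat.card (translationStabilizer C₁ ⊓ translationStabilizer C₂ : AddSubgroup G) := ⟨_, rfl⟩
  have hkpos : 0 < k := hk ▸ Nat.card_pos
  have hkle : k ≤ Nat.card (translationStabilizer (C₁ ∪ C₂)) := by
    rw [hk]
    exact AddSubgroup.card_le_of_le fun g hg x ↦ or_congr (hg.1 x) (hg.2 x)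
  have hcard₁ : (C₂ \ C₁).ncard + C₁.ncard = (C₁ ∪ C₂).ncard := by
    rw [Set.ncard_sdiff_add_ncard, Set.union_comm]
  have hcard₂ : (C₁ \ C₂).ncard + C₂.ncard = (C₁ ∪ C₂).ncard := Set.ncard_sdiff_add_ncard _ _
  by_contra! hlt
  obtain ⟨u, p, v, q, hup, hvq, he, hf, hu, -, -, hq, -, hp, hv, -⟩ :=
    exists_local_counts C₁ C₂ c hk
  obtain ⟨u', p', v', q', hup', hvq', he', hf', -, hp', hv', -, hu', -, -, hq'⟩ :=
    exists_local_counts C₁ C₂ c' hk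
  replace hp := hp hc.2
  replace hv := hv hc.1
  replace hu' := hu' hc'.1
  replace hq' := hq' hc'.2
  generalize Nat.card (translationStabilizer C₁) = a₁ at *
  generalize Nat.card (translationStabilizer C₂) = a₂ at *
  generalize (C₂ \ C₁).ncard = e at *
  generalize (C₁ \ C₂).ncard = f at *
  have he_lt : e + k < a₁ := by omega
  have hf_lt : f + k < a₂ := by omega
  have hae : a₂ ≤ e := by
    rcases hu with rfl | hu
    · refine le_of_mul_le_mul_left (le_trans ?_ he) hkpos
      obtain rfl : p = a₂ := by omega
      gcongr
    rcases hq with rfl | hq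
    · have : a₁ ≤ e := by
        refine le_of_mul_le_mul_left (le_trans ?_ he) hkpos
        obtain rfl : v = a₁ := by omega
        rw [mul_comm]
        gcongr
      omega
    · have := add_le_add_of_mul_le_mul hkpos hu hp hv hq he hf
      omega
  have haf : a₁ ≤ f := by
    rcases hv' with rfl | hv'
    · refine le_of_mul_le_mul_left (le_trans ?_ hf') hkpos
      obtain rfl : q' = a₁ := by omega
      rw [mul_comm]
      gcongr
    rcases hp' with rfl | hp'
    · have : a₂ ≤ f := by
        refine le_of_mul_le_mul_left (le_trans ?_ hf') hkpos
        obtain rfl : u' = a₂ := by omega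
        gcongr
      omega
    · have := add_le_add_of_mul_le_mul hkpos hu' hp' hv' hq' he' hf'
      omega
  omega

open scoped Pointwise

lemma exists_subset_add_le_ncard {G : Type*} [AddCommGroup G] [Finite G] (n : ℕ) :
    ∀ A B : Set G, B.ncard ≤ n → ∀ a₀ ∈ A, ∀ b₀ ∈ B, ∃ C ⊆ A + B, a₀ + b₀ ∈ C ∧
      A.ncard + B.ncard ≤ C.ncard + Nat.card (translationStabilizer C) := by
  induction n with
  | zero =>
    intro A B hB a₀ _ b₀ hb₀
    rw [Nat.le_zero, Set.ncard_eq_zero] at hB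
    simp [hB] at hb₀
  | succ n ih =>
    intro A B hB a₀ ha₀ b₀ hb₀
    by_cases hstab : ∀ a ∈ A, ∀ b ∈ B, a + b - b₀ ∈ A
    · have hA (b : G) (hb : b ∈ B) : b - b₀ ∈ translationStabilizer A := by
        have himage : (fun x ↦ x + (b - b₀)) '' A = A := by
          refine Set.eq_of_subset_of_ncard_le ?_
            (Set.ncard_image_of_injective _ (add_left_injective _)).ge
          rintro _ ⟨a, ha, rfl⟩
          simpa [add_sub_assoc] using hstab a ha b hb
        intro x
        conv_lhs => rw [← himage]
        exact (add_left_injective (b - b₀)).mem_set_image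
      refine ⟨(fun x ↦ x + b₀) '' A, ?_, ⟨a₀, ha₀, rfl⟩, ?_⟩
      · rintro _ ⟨a, ha, rfl⟩
        exact Set.add_mem_add ha hb₀
      rw [Set.ncard_image_of_injective _ (add_left_injective _)]
      gcongr
      rw [← Set.ncard_image_of_injective B (sub_left_injective (b := b₀)), ← SetLike.coe_sort_coe,
        Nat.card_coe_set_eq]
      refine Set.ncard_le_ncard ?_ (Set.toFinite _)
      rintro _ ⟨b, hb, rfl⟩ x
      rw [Set.image_add_right]
      change x + (b - b₀) + -b₀ ∈ A ↔ x + -b₀ ∈ A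
      rw [add_right_comm, hA b hb]
    · push Not at hstab
      obtain ⟨a, ha, b, hb, hab⟩ := hstab
      set e := a - b₀ with he
      have hb₀' : b₀ ∈ {y ∈ B | y + e ∈ A} := ⟨hb₀, by simpa [he] using ha⟩
      have hlt : {y ∈ B | y + e ∈ A}.ncard < B.ncard := by
        refine Set.ncard_lt_ncard ⟨Set.sep_subset _ _, fun h ↦ hab ?_⟩ (Set.toFinite _)
        have := (h hb).2
        rwa [he, add_sub_left_comm, ← add_sub_assoc] at this
      obtain ⟨C, hC, hmem, hcard⟩ := ih (A ∪ (fun y ↦ y + e) '' B) {y ∈ B | y + e ∈ A} (by omega)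
        a₀ (Or.inl ha₀) b₀ hb₀'
      refine ⟨C, hC.trans ?_, hmem, le_trans (le_of_eq ?_) hcard⟩
      · rintro _ ⟨x, hx | ⟨y, hy, rfl⟩, z, hz, rfl⟩
        · exact Set.add_mem_add hx hz.1
        · refine ⟨z + e, hz.2, y, hy, ?_⟩
          change z + e + y = y + e + z
          abel
      · have himage : (fun y ↦ y + e) '' {y ∈ B | y + e ∈ A} = A ∩ (fun y ↦ y + e) '' B := by
          ext x
          constructor
          · rintro ⟨y, hy, rfl⟩
            exact ⟨hy.2, y, hy.1, rfl⟩
          · rintro ⟨hx, y, hy, rfl⟩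
            exact ⟨y, ⟨hy, hx⟩, rfl⟩
        rw [← Set.ncard_image_of_injective {y ∈ B | y + e ∈ A} (add_left_injective e), himage,
          Set.ncard_union_add_ncard_inter,
          Set.ncard_image_of_injective _ (add_left_injective e)]

/-- **Kneser's theorem** (weak form). -/
theorem ncard_add_ncard_le_ncard_add {G : Type*} [AddCommGroup G] [Finite G] {A B : Set G}
    (hA : A.Nonempty) (hB : B.Nonempty) :
    A.ncard + B.ncard ≤ (A + B).ncard + Nat.card (translationStabilizer (A + B)) := by
  obtain ⟨a₁, ha₁⟩ := hA
  obtain ⟨b₁, hb₁⟩ := hB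
  have hlocal {a b : G} (ha : a ∈ A) (hb : b ∈ B) :=
    exists_subset_add_le_ncard B.ncard A B le_rfl a ha b hb
  obtain ⟨C, ⟨hC, hcard⟩, hmax⟩ := Set.exists_max_image
    {C : Set G | C ⊆ A + B ∧ A.ncard + B.ncard ≤ C.ncard + Nat.card (translationStabilizer C)}
    Set.ncard (Set.toFinite _) (by
      obtain ⟨C, hC, -, hcard⟩ := hlocal ha₁ hb₁
      exact ⟨C, hC, hcard⟩)
  obtain rfl : C = A + B := by
    refine hC.antisymm ?_
    rintro _ ⟨a, ha, b, hb, rfl⟩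
    obtain ⟨C', hC', hmem, hcard'⟩ := hlocal ha hb
    have hle := hmax (C ∪ C')
      ⟨Set.union_subset hC hC', le_ncard_union_add_card_stabilizer hcard hcard'⟩
    rw [Set.eq_of_subset_of_ncard_le Set.subset_union_left hle (Set.toFinite _)]
    exact Or.inr hmem
  exact hcard

lemma mod_three_ne_two {m : ℕ} (h : ∀ p : ℕ, p.Prime → p % 3 = 2 → ¬ p ∣ m) : m % 3 ≠ 2 := by
  induction m using Nat.recOnMul with
  | zero => simp
  | one => simp
  | prime p hp => exact fun h2 ↦ h p hp h2 dvd_rfl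
  | mul a b iha ihb =>
    have ha := iha fun p hp h2 hdvd ↦ h p hp h2 (hdvd.mul_right b)
    have hb := ihb fun p hp h2 hdvd ↦ h p hp h2 (hdvd.mul_left a)
    have ha' : a % 3 = 0 ∨ a % 3 = 1 := by omega
    have hb' : b % 3 = 0 ∨ b % 3 = 1 := by omega
    rw [Nat.mul_mod]
    rcases ha' with ha' | ha' <;> rcases hb' with hb' | hb' <;> simp [ha', hb']

lemma card_dvd_ncard_add {G : Type*} [AddCommGroup G] (A : Set G) (H : AddSubgroup G) :
    Nat.card H ∣ (A + (H : Set G)).ncard := by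
  have : A + (H : Set G) = QuotientAddGroup.mk ⁻¹' ((QuotientAddGroup.mk : G → G ⧸ H) '' A) := by
    ext x
    constructor
    · rintro ⟨a, ha, h, hh, rfl⟩
      exact ⟨a, ha, (QuotientAddGroup.eq.2 (by simpa using hh))⟩
    · rintro ⟨a, ha, hax⟩
      exact ⟨a, ha, -a + x, QuotientAddGroup.eq.1 hax, by simp⟩
  rw [this, ← Nat.card_coe_set_eq, Nat.card_congr
    (QuotientAddGroup.preimageMkEquivAddSubgroupProdSet H _), Nat.card_prod]
  exact dvd_mul_right _ _

/-- In a group whose order has no prime factor congruent to `2` modulo `3`, sum-free sets have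
density at most `1 / 3`. -/
theorem IsSumFree.three_mul_ncard_le {G : Type*} [AddCommGroup G] [Finite G]
    (hG : ∀ p : ℕ, p.Prime → p % 3 = 2 → ¬ p ∣ Nat.card G) {A : Set G} (hA : IsSumFree A) :
    3 * A.ncard ≤ Nat.card G := by
  rcases A.eq_empty_or_nonempty with rfl | hne
  · simp
  set H := translationStabilizer (A + A) with hH
  set A' := A + (H : Set G) with hA'
  have hsub : A ⊆ A' := fun a ha ↦ ⟨a, ha, 0, zero_mem H, add_zero a⟩
  have hadd : A' + A' = A + A := by
    refine Set.Subset.antisymm ?_ (Set.add_subset_add hsub hsub)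
    rintro _ ⟨_, ⟨a, ha, h, hh, rfl⟩, _, ⟨b, hb, h', hh', rfl⟩, rfl⟩
    change (a + h) + (b + h') ∈ A + A
    rw [add_add_add_comm, mem_translationStabilizer.1 (add_mem hh hh')]
    exact Set.add_mem_add ha hb
  have hdisj : Disjoint A' (A + A) := by
    rw [Set.disjoint_left]
    rintro _ ⟨a, ha, h, hh, rfl⟩ hmem
    obtain ⟨x, hx, y, hy, hxy⟩ := (mem_translationStabilizer.1 hh a).1 hmem
    exact hA x hx y hy (by rwa [show x + y = a from hxy])
  have hkneser := ncard_add_ncard_le_ncard_add (hne.mono hsub) (hne.mono hsub)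
  rw [hadd] at hkneser
  have hcard : A'.ncard + (A + A).ncard ≤ Nat.card G := by
    rw [← Set.ncard_union_eq hdisj]
    exact Set.ncard_le_card _
  obtain ⟨a, ha⟩ := card_dvd_ncard_add A H
  obtain ⟨m, hm⟩ := H.card_addSubgroup_dvd_card
  have hmod : m % 3 ≠ 2 := mod_three_ne_two fun p hp h2 hdvd ↦
    hG p hp h2 (hm ▸ hdvd.mul_left _)
  have hpos : 0 < Nat.card H := Nat.card_pos
  have hle := Set.ncard_le_ncard hsub (Set.toFinite _)
  have h3 : Nat.card H * (3 * a) ≤ Nat.card H * (m + 1) := by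
    rw [← hH, ← hA'] at *
    nlinarith
  have h3' : 3 * a ≤ m := by
    have := le_of_mul_le_mul_left h3 hpos
    omega
  calc 3 * A.ncard ≤ 3 * A'.ncard := by gcongr
    _ = Nat.card H * (3 * a) := by rw [hA', ha]; ring
    _ ≤ Nat.card H * m := by gcongr
    _ = Nat.card G := hm.symm

lemma exists_linearMap_surjective {K V : Type*} [Field K] [AddCommGroup V] [Module K V] {v : V}
    (hv : v ≠ 0) : ∃ f : V →ₗ[K] K, Function.Surjective f := by
  obtain ⟨f, hf⟩ : ∃ f : Module.Dual K V, f v ≠ 0 := by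
    by_contra! h
    exact hv ((Module.forall_dual_apply_eq_zero_iff K v).1 h)
  exact ⟨f, LinearMap.surjective fun h ↦ hf (by simp [h])⟩

lemma exists_surjective_zmod {G : Type*} [AddCommGroup G] [Finite G] {p : ℕ} [Fact p.Prime]
    (hp : p ∣ Nat.card G) : ∃ φ : G →+ ZMod p, Function.Surjective φ := by
  obtain ⟨x, hx⟩ := exists_prime_addOrderOf_dvd_card' p hp
  have hsurj : ¬ Function.Surjective (nsmulAddMonoidHom (α := G) p) := by
    rw [← Finite.injective_iff_surjective]
    intro hinj
    have h0 : x = 0 := hinj (by simp [← hx, addOrderOf_nsmul_eq_zero])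
    rw [h0, addOrderOf_zero] at hx
    exact (Fact.out : p.Prime).one_lt.ne hx
  obtain ⟨y, hy⟩ : ∃ y, y ∉ (nsmulAddMonoidHom (α := G) p).range := by
    by_contra! h
    exact hsurj h
  let Q := G ⧸ (nsmulAddMonoidHom (α := G) p).range
  let _ : Module (ZMod p) Q := AddCommGroup.zmodModule fun q ↦ by
    induction q using QuotientAddGroup.induction_on with
    | H z => exact (QuotientAddGroup.eq_zero_iff (p • z)).2 ⟨z, rfl⟩
  have hne : (QuotientAddGroup.mk y : Q) ≠ 0 := fun h ↦ hy ((QuotientAddGroup.eq_zero_iff y).1 h)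
  obtain ⟨f, hf⟩ := exists_linearMap_surjective (K := ZMod p) hne
  exact ⟨f.toAddMonoidHom.comp (QuotientAddGroup.mk' _),
    hf.comp (QuotientAddGroup.mk'_surjective _)⟩

lemma card_ker_mul {G : Type*} [AddCommGroup G] [Finite G] {p : ℕ} {φ : G →+ ZMod p}
    (hφ : Function.Surjective φ) : p * Nat.card φ.ker = Nat.card G := by
  rw [← φ.ker.index_mul_card, AddSubgroup.index_ker, AddMonoidHom.range_eq_top.2 hφ,
    AddSubgroup.card_top, Nat.card_zmod]

lemma card_le_three_mul_sumFreeMu {G : Type*} [AddCommGroup G] [Fintype G]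
    (h3 : 3 ∣ Fintype.card G) : Fintype.card G ≤ 3 * sumFreeMu G := by
  rw [← Nat.card_eq_fintype_card] at h3 ⊢
  obtain ⟨φ, hφ⟩ := exists_surjective_zmod h3
  obtain ⟨x, hx⟩ := hφ 1
  have hfree : IsSumFree ((fun h ↦ x + h) '' (φ.ker : Set G)) := by
    rintro _ ⟨a, ha, rfl⟩ _ ⟨b, hb, rfl⟩ ⟨c, hc, h⟩
    have h' := congrArg φ h
    rw [SetLike.mem_coe, AddMonoidHom.mem_ker] at ha hb hc
    simp only [map_add, hx, ha, hb, hc] at h'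
    exact absurd h' (by decide)
  have := ncard_le_sumFreeMu hfree
  rw [Set.ncard_image_of_injective _ (add_right_injective x), ← Nat.card_coe_set_eq,
    SetLike.coe_sort_coe] at this
  rw [← card_ker_mul hφ]
  gcongr

lemma IsSumFree.exists_isMaximalSumFree {G : Type*} [AddCommGroup G] [Finite G] {A : Set G}
    (hA : IsSumFree A) : ∃ B, A ⊆ B ∧ IsMaximalSumFree B := by
  obtain ⟨B, hAB, hB⟩ := (Set.toFinite {B : Set G | IsSumFree B}).exists_le_maximal hA
  exact ⟨B, hAB, hB.prop, fun D hD hBD ↦ hBD.antisymm (hB.2 hD hBD)⟩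

/-- If `9` divides the order of `G`, then `G` has at least `3 ^ (|G| / 9)` maximal sum-free sets. -/
theorem exists_three_pow_le_fMaxSF {G : Type*} [AddCommGroup G] [Fintype G]
    (h9 : 9 ∣ Fintype.card G) : ∃ q : ℕ, 9 * q = Fintype.card G ∧ 3 ^ q ≤ fMaxSF G := by
  rw [← Nat.card_eq_fintype_card] at h9 ⊢
  obtain ⟨φ, hφ⟩ := exists_surjective_zmod (dvd_trans (by norm_num : 3 ∣ 9) h9)
  obtain ⟨x, hx⟩ := hφ 1
  have hker := card_ker_mul hφ
  obtain ⟨s, hs⟩ := exists_prime_addOrderOf_dvd_card' (G := φ.ker) 3 (by omega)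
  set T := AddSubgroup.zmultiples s with hT
  have hTcard : Nat.card T = 3 := by rw [hT, Nat.card_zmultiples, hs]
  have hs0 : s ≠ 0 := by
    rintro rfl
    simp at hs
  have hTmem {t : φ.ker} (ht : t ∈ T) : t = 0 ∨ t = s ∨ t = -s := by
    obtain ⟨k, rfl⟩ := AddSubgroup.mem_zmultiples_iff.1 ht
    have h3 : (3 : ℤ) • s = 0 := by
      have := addOrderOf_nsmul_eq_zero s
      rw [hs] at this
      exact_mod_cast this
    have hk : k • s = (k % 3) • s := by
      conv_lhs => rw [← Int.emod_add_mul_ediv k 3]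
      rw [add_zsmul, mul_comm, mul_zsmul, h3, zsmul_zero, add_zero]
    have hcases : k % 3 = 0 ∨ k % 3 = 1 ∨ k % 3 = 2 := by omega
    rw [hk]
    rcases hcases with h | h | h <;> rw [h]
    · simp
    · simp
    · refine Or.inr (Or.inr ?_)
      rw [eq_neg_iff_add_eq_zero, ← h3]
      abel
  have hQcard : 3 * Nat.card (φ.ker ⧸ T) = Nat.card φ.ker := by
    rw [T.card_eq_card_quotient_mul_card_addSubgroup, hTcard, mul_comm]
  let pt : (φ.ker ⧸ T) → T → G := fun q t ↦ x + ((q.out + t : φ.ker) : G)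
  have hpt (q : φ.ker ⧸ T) (t : T) : φ (pt q t) = 1 := by
    simp only [pt, map_add, hx, AddMonoidHom.mem_ker.1 (q.out + t : φ.ker).2, add_zero]
  have hφs : φ s = 0 := AddMonoidHom.mem_ker.1 s.2
  have hfree (f : (φ.ker ⧸ T) → T) :
      IsSumFree (insert (s : G) (Set.range fun q ↦ pt q (f q))) := by
    have hshift (r q : φ.ker ⧸ T) : r.out + (f r : φ.ker) ≠ s + (q.out + f q) := by
      intro h
      have hrq : r = q := by
        have := congrArg (QuotientAddGroup.mk : φ.ker → φ.ker ⧸ T) h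
        have hsT : (QuotientAddGroup.mk s : φ.ker ⧸ T) = 0 :=
          (QuotientAddGroup.eq_zero_iff s).2 (AddSubgroup.mem_zmultiples s)
        have hzero (t : T) : (QuotientAddGroup.mk (t : φ.ker) : φ.ker ⧸ T) = 0 :=
          (QuotientAddGroup.eq_zero_iff _).2 t.2
        simpa [QuotientAddGroup.mk_add, hsT, hzero] using this
      subst hrq
      exact hs0 (by simpa using h)
    rintro _ (rfl | ⟨q, rfl⟩) _ (rfl | ⟨q', rfl⟩) (h | ⟨r, h⟩)
    · exact hs0 (by simpa using h)
    · have := congrArg φ h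
      simp only [map_add, hpt, hφs] at this
      exact absurd this (by decide)
    · have := congrArg φ h
      simp only [map_add, hpt, hφs] at this
      exact absurd this (by decide)
    · refine hshift r q' (Subtype.ext ?_)
      have : x + ((r.out + f r : φ.ker) : G) = s + (x + ((q'.out + f q' : φ.ker) : G)) := h
      rw [add_left_comm] at this
      exact add_left_cancel this
    · have := congrArg φ h
      simp only [map_add, hpt, hφs] at this
      exact absurd this (by decide)
    · refine hshift r q (Subtype.ext ?_)
      have : x + ((r.out + f r : φ.ker) : G) = x + ((q.out + f q : φ.ker) : G) + s := h
      rw [add_assoc] at this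
      rw [add_comm (s : φ.ker)]
      exact add_left_cancel this
    · have := congrArg φ h
      simp only [map_add, hpt, hφs] at this
      exact absurd this (by decide)
    · have := congrArg φ h
      simp only [map_add, hpt] at this
      exact absurd this (by decide)
  choose E hsub hmax using fun f ↦ (hfree f).exists_isMaximalSumFree
  have hinj : Function.Injective fun f ↦ (⟨E f, hmax f⟩ : {A : Set G // IsMaximalSumFree A}) := by
    intro f g hfg
    have hE : E f = E g := congrArg Subtype.val hfg
    have hsE : (s : G) ∈ E f := hsub f (Set.mem_insert _ _)
    funext q
    have hfE : pt q (f q) ∈ E f := hsub f (Or.inr ⟨q, rfl⟩)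
    have hgE : pt q (g q) ∈ E f := hE ▸ hsub g (Or.inr ⟨q, rfl⟩)
    rcases hTmem (sub_mem (f q).2 (g q).2) with h | h | h
    · exact Subtype.ext (sub_eq_zero.1 h)
    · refine absurd hfE ?_
      have : pt q (f q) = s + pt q (g q) := by
        simp only [pt, ← h]
        push_cast
        abel
      rw [this]
      exact (hmax f).1 _ hsE _ hgE
    · refine absurd hgE ?_
      have : pt q (g q) = s + pt q (f q) := by
        rw [← neg_eq_iff_eq_neg, neg_sub] at h
        simp only [pt, ← h]
        push_cast
        abel
      rw [this]
      exact (hmax f).1 _ hsE _ hfE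
  refine ⟨Nat.card (φ.ker ⧸ T), by omega, ?_⟩
  have := Nat.card_le_card_of_injective _ hinj
  rwa [Nat.card_fun, hTcard] at this

open Classical in
/-- Upper bound for the number of maximal sum-free sets in terms of the largest one. -/
theorem exists_fMaxSF_le_rpow {η : ℝ} (hη : 0 < η) :
    ∃ n₀ : ℕ, ∀ (G : Type) [AddCommGroup G] [Fintype G], Fintype.card G ≥ n₀ →
      (fMaxSF G : ℝ) ≤ 3 ^ (sumFreeMu G / 3 + 2 * η * Fintype.card G) := by
  obtain ⟨δ, hδ, hremoval⟩ := exists_sumFree_sdiff hη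
  obtain ⟨n₀, hn₀⟩ := exists_sumFree_containers hδ
    (Real.one_lt_rpow (by norm_num : (1 : ℝ) < 3) hη)
  refine ⟨n₀, fun G _ _ hn ↦ ?_⟩
  obtain ⟨F, hF, hcov, hfew⟩ := hn₀ G hn
  set n := Fintype.card G
  have hmany : ∀ D ∈ F, (#{I : Finset G | IsMaximalSumFree (I : Set G) ∧ I ⊆ D} : ℝ) ≤
      3 ^ (sumFreeMu G / 3 + η * n) := by
    intro D hD
    obtain ⟨B, hBD, hB, hA⟩ := hremoval G D (hfew D hD)
    have hcount := card_isMaximalSumFree_subset_pow_three_le (B := B) hA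
    rw [sdiff_union_of_subset hBD] at hcount
    have hAμ := ncard_le_sumFreeMu hA
    rw [Set.ncard_coe_finset] at hAμ
    refine le_of_pow_le_pow_left₀ (by norm_num : 3 ≠ 0) (by positivity) ?_
    calc (#{I : Finset G | IsMaximalSumFree (I : Set G) ∧ I ⊆ D} : ℝ) ^ 3
        ≤ 2 ^ (3 * #B) * 3 ^ #(D \ B) := by exact_mod_cast hcount
      _ ≤ 3 ^ (3 * #B) * 3 ^ sumFreeMu G := by
        gcongr <;> norm_num
      _ = (3 : ℝ) ^ ((3 * #B + sumFreeMu G : ℕ) : ℝ) := by rw [Real.rpow_natCast, pow_add]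
      _ ≤ 3 ^ ((sumFreeMu G / 3 + η * n) * (3 : ℕ)) := by
        refine Real.rpow_le_rpow_of_exponent_le (by norm_num) ?_
        push_cast
        linarith
      _ = (3 ^ (sumFreeMu G / 3 + η * n)) ^ 3 := Real.rpow_mul_natCast (by norm_num) _ _
  have hcover : ({I : Finset G | IsMaximalSumFree (I : Set G)} : Finset _) ⊆
      F.biUnion fun D ↦ {I : Finset G | IsMaximalSumFree (I : Set G) ∧ I ⊆ D} := by
    intro I hI
    have hI' := (mem_filter.1 hI).2
    obtain ⟨D, hD, hID⟩ := hcov I hI'.1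
    exact mem_biUnion.2 ⟨D, hD, mem_filter.2 ⟨mem_univ _, hI', hID⟩⟩
  calc (fMaxSF G : ℝ)
      ≤ ∑ D ∈ F, (#{I : Finset G | IsMaximalSumFree (I : Set G) ∧ I ⊆ D} : ℝ) := by
        rw [fMaxSF_eq_card]
        exact_mod_cast (card_le_card hcover).trans card_biUnion_le
    _ ≤ ∑ D ∈ F, (3 : ℝ) ^ (sumFreeMu G / 3 + η * n) := sum_le_sum hmany
    _ = #F * (3 : ℝ) ^ (sumFreeMu G / 3 + η * n) := by rw [sum_const, nsmul_eq_mul]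
    _ ≤ (3 ^ η) ^ n * (3 : ℝ) ^ (sumFreeMu G / 3 + η * n) := by gcongr
    _ = 3 ^ (sumFreeMu G / 3 + 2 * η * n) := by
        rw [← Real.rpow_mul_natCast (by norm_num), ← Real.rpow_add (by norm_num)]
        ring_nf

theorem count_maximal_sumfree_sets_type_II_divisible_by_nine :
    ∀ ε : ℝ, ε > 0 → ∃ n₀ : ℕ,
      ∀ (G : Type) [AddCommGroup G] [Fintype G],
        Fintype.card G ≥ n₀ → 9 ∣ Fintype.card G →
        (∀ p : ℕ, p.Prime → p % 3 = 2 → ¬ p ∣ Fintype.card G) →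
        (3 : ℝ) ^ ((1 / 3 - ε) * sumFreeMu G) ≤ fMaxSF G ∧
          (fMaxSF G : ℝ) ≤ 3 ^ ((1 / 3 + ε) * sumFreeMu G) := by
  intro ε hε
  obtain ⟨n₀, hn₀⟩ := exists_fMaxSF_le_rpow (by positivity : 0 < ε / 6)
  refine ⟨n₀, fun G _ _ hn h9 hG ↦ ⟨?_, ?_⟩⟩
  · obtain ⟨q, hq, hle⟩ := exists_three_pow_le_fMaxSF h9
    obtain ⟨A, hA, hAμ⟩ := exists_ncard_eq_sumFreeMu G
    have hμ := hA.three_mul_ncard_le (by rwa [Nat.card_eq_fintype_card])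
    rw [hAμ, Nat.card_eq_fintype_card, ← hq] at hμ
    have hμ' : (3 * sumFreeMu G : ℝ) ≤ 9 * q := by exact_mod_cast hμ
    calc (3 : ℝ) ^ ((1 / 3 - ε) * sumFreeMu G) ≤ 3 ^ (q : ℝ) := by
          refine Real.rpow_le_rpow_of_exponent_le (by norm_num) ?_
          have : 0 ≤ ε * sumFreeMu G := by positivity
          linarith
      _ ≤ fMaxSF G := by
          rw [Real.rpow_natCast]
          exact_mod_cast hle
  · refine (hn₀ G hn).trans (Real.rpow_le_rpow_of_exponent_le (by norm_num) ?_)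
    have hcard : (Fintype.card G : ℝ) ≤ 3 * sumFreeMu G := by
      exact_mod_cast card_le_three_mul_sumFreeMu (dvd_trans (by norm_num : 3 ∣ 9) h9)
    nlinarith
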